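/- arXiv:1907.03275 — 3 statements merged into one kernel-verified Lean document; each statement's English description precedes it below -/
import Mathlib

section
/- A delta-matroid D is binary if it has no minor isomorphic to a twist of S₁, S₂, S₃, S₄, or S₅, where S₁ = ({1,2,3}, {∅,{1,2},{1,3},{2,3},{1,2,3}}), S₂ = ({1,2,3}, {∅,{1},{2},{3},{1,2},{1,3},{2,3}}), S₃ = ({1,2,3}, {∅,{2},{3},{1,2},{1,3},{1,2,3}}), S₄ = ({1,2,3,4}, {∅,{1,2},{1,3},{1,4},{2,3},{2,4},{3,4}}), and S₅ = ({1,2,3,4}, {∅,{1,2},{1,4},{2,3},{3,4},{1,2,3,4}}). Here two set systems (E, 𝓕) and (E′, 𝓕′) are isomorphic if there is a bijection φ : E → E′ with 𝓕′ = {φ(F) : F ∈ 𝓕}. -/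
/-- A set system: a finite ground set `E` together with a collection `F`
of finite subsets (intended to be subsets of `E`). -/
structure SetSystem (α : Type*) where
  E : Finset α
  F : Set (Finset α)

namespace SetSystem

variable {α : Type*} [DecidableEq α]

/-- A delta-matroid: a set system with nonempty feasible collection, all feasible
sets contained in the ground set, satisfying the symmetric exchange axiom. -/
def IsDeltaMatroid (D : SetSystem α) : Prop :=
  D.F.Nonempty ∧ (∀ F ∈ D.F, F ⊆ D.E) ∧
    ∀ F₁ ∈ D.F, ∀ F₂ ∈ D.F, ∀ x ∈ symmDiff F₁ F₂,
      ∃ y ∈ symmDiff F₁ F₂, symmDiff F₁ {x, y} ∈ D.F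

/-- The handle slide taking `a` over `b`:
`𝓕_{ab} = 𝓕 Δ {X ∪ {a} : X ⊆ E − {a,b}, X ∪ {b} ∈ 𝓕}`. -/
def slide (D : SetSystem α) (a b : α) : SetSystem α :=
  ⟨D.E, symmDiff D.F
    {Y : Finset α | ∃ X : Finset α, X ⊆ D.E \ {a, b} ∧ X ∪ {b} ∈ D.F ∧ Y = X ∪ {a}}⟩

/-- Iterated handle slides along a list of pairs. -/
def slides (D : SetSystem α) : List (α × α) → SetSystem α
  | [] => D
  | (a, b) :: L => slides (D.slide a b) L

/-- The twist `D ⋆ A = (E, {A Δ X : X ∈ 𝓕})`. -/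
def twist (D : SetSystem α) (A : Finset α) : SetSystem α :=
  ⟨D.E, {Y : Finset α | ∃ X ∈ D.F, Y = symmDiff A X}⟩

/-- Deletion of `e`: `D − e = (E − e, {F : F ⊆ E − e, F ∈ 𝓕})`. -/
def del (D : SetSystem α) (e : α) : SetSystem α :=
  ⟨D.E.erase e, {F : Finset α | F ⊆ D.E.erase e ∧ F ∈ D.F}⟩

/-- Contraction of `e`: `D/e = (E − e, {F : F ⊆ E − e, F ∪ {e} ∈ 𝓕})`. -/
def contr (D : SetSystem α) (e : α) : SetSystem α :=
  ⟨D.E.erase e, {F : Finset α | F ⊆ D.E.erase e ∧ F ∪ {e} ∈ D.F}⟩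

/-- The set system `D(A)` of a symmetric binary matrix `A` indexed by `E`:
feasible sets are the `W ⊆ E` whose principal submatrix `A[W]` is invertible
(the empty submatrix being invertible by convention). -/
def ofMatrix (E : Finset α) (A : Matrix E E (ZMod 2)) : SetSystem α :=
  ⟨E, {W : Finset α | ∃ h : ∀ x ∈ W, x ∈ E,
        IsUnit (Matrix.submatrix A
          (fun i : W => (⟨i.1, h i.1 i.2⟩ : E)) (fun i : W => (⟨i.1, h i.1 i.2⟩ : E)))}⟩

/-- `D` is binary: `D = D(A) ⋆ F` for some feasible `F ∈ 𝓕` and some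
symmetric matrix `A` over GF(2) indexed by the ground set. -/
def IsBinary (D : SetSystem α) : Prop :=
  ∃ F ∈ D.F, ∃ A : Matrix D.E D.E (ZMod 2),
    A.IsSymm ∧ D = (ofMatrix D.E A).twist F

/-- `IsMinor D T`: `T` is obtained from `D` by a sequence of deletions and
contractions (keeping feasible collections nonempty). -/
inductive IsMinor : SetSystem α → SetSystem α → Prop
  | refl (D : SetSystem α) : IsMinor D D
  | del {D T : SetSystem α} (e : α) (he : e ∈ D.E) (hne : (D.del e).F.Nonempty)
      (h : IsMinor (D.del e) T) : IsMinor D T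
  | contr {D T : SetSystem α} (e : α) (he : e ∈ D.E) (hne : (D.contr e).F.Nonempty)
      (h : IsMinor (D.contr e) T) : IsMinor D T

/-- Isomorphism of set systems: a bijection of ground sets carrying one
feasible collection onto the other. -/
def Isomorphic {β : Type*} [DecidableEq β] (D : SetSystem α) (D' : SetSystem β) : Prop :=
  ∃ φ : α → β, Set.InjOn φ D.E ∧ D.E.image φ = D'.E ∧
    D'.F = {Y : Finset β | ∃ X ∈ D.F, Y = X.image φ}

end SetSystem

open SetSystem

/-- The minimal non-binary delta-matroids of Bouchet–Duchamp. -/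
def S₁ : SetSystem ℕ := ⟨{1, 2, 3}, {∅, {1, 2}, {1, 3}, {2, 3}, {1, 2, 3}}⟩
def S₂ : SetSystem ℕ := ⟨{1, 2, 3}, {∅, {1}, {2}, {3}, {1, 2}, {1, 3}, {2, 3}}⟩
def S₃ : SetSystem ℕ := ⟨{1, 2, 3}, {∅, {2}, {3}, {1, 2}, {1, 3}, {1, 2, 3}}⟩
def S₄ : SetSystem ℕ := ⟨{1, 2, 3, 4}, {∅, {1, 2}, {1, 3}, {1, 4}, {2, 3}, {2, 4}, {3, 4}}⟩
def S₅ : SetSystem ℕ := ⟨{1, 2, 3, 4}, {∅, {1, 2}, {1, 4}, {2, 3}, {3, 4}, {1, 2, 3, 4}}⟩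


namespace BinaryDeltaMatroid

open Finset Matrix

section Nonsingular

variable {ι κ : Type*} [Fintype ι] [Fintype κ]

/-- The principal submatrix `M[W]` has trivial kernel. -/
def Nonsing (M : Matrix ι ι (ZMod 2)) (W : Finset ι) : Prop :=
  ∀ x : ι → ZMod 2, (∀ i ∉ W, x i = 0) → (∀ i ∈ W, (M *ᵥ x) i = 0) → x = 0

theorem nonsing_empty (M : Matrix ι ι (ZMod 2)) : Nonsing M ∅ :=
  fun _ hx _ => funext fun i => hx i (notMem_empty i)

theorem mulVec_eq_submatrix_mulVec (M : Matrix ι ι (ZMod 2)) (f : κ ↪ ι) {x : ι → ZMod 2}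
    (hx : ∀ i ∉ univ.map f, x i = 0) (k : κ) :
    (M *ᵥ x) (f k) = (M.submatrix f f *ᵥ (x ∘ f)) k := by
  simp only [mulVec, dotProduct, submatrix_apply, Function.comp]
  rw [← Finset.sum_map univ f (fun j => M (f k) j * x j)]
  exact (Finset.sum_subset (subset_univ _) fun i _ hi => by rw [hx i hi, mul_zero]).symm

variable [DecidableEq ι] [DecidableEq κ]

theorem nonsing_map (M : Matrix ι ι (ZMod 2)) (f : κ ↪ ι) :
    Nonsing M (univ.map f) ↔ (M.submatrix f f).det ≠ 0 := by
  rw [Ne, ← exists_mulVec_eq_zero_iff]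
  constructor
  · rintro h ⟨v, hv, hMv⟩
    have hx : ∀ i ∉ univ.map f, Function.extend f v 0 i = 0 := fun i hi =>
      Function.extend_apply' _ _ _ fun ⟨k, hk⟩ => hi (by simp [← hk])
    have hcomp : Function.extend f v 0 ∘ f = v := Function.extend_comp f.injective _ _
    have := h _ hx fun i hi => by
      obtain ⟨k, -, rfl⟩ := mem_map.1 hi
      rw [mulVec_eq_submatrix_mulVec M f hx, hcomp, hMv, Pi.zero_apply]
    exact hv (by rw [← hcomp, this]; rfl)
  · intro h x hx hMx
    have hxf : x ∘ f = 0 := by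
      by_contra hne
      refine h ⟨x ∘ f, hne, funext fun k => ?_⟩
      rw [← mulVec_eq_submatrix_mulVec M f hx, hMx _ (by simp), Pi.zero_apply]
    funext i
    by_cases hi : i ∈ univ.map f
    · obtain ⟨k, -, rfl⟩ := mem_map.1 hi
      exact congrFun hxf k
    · exact hx i hi

theorem nonsing_congr {M N : Matrix ι ι (ZMod 2)} {W : Finset ι}
    (h : ∀ i ∈ W, ∀ j ∈ W, M i j = N i j) : Nonsing M W ↔ Nonsing N W := by
  have hW : univ.map (Function.Embedding.subtype (· ∈ W)) = W := by ext; simp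
  have hMN : M.submatrix (Function.Embedding.subtype (· ∈ W)) (Function.Embedding.subtype (· ∈ W)) =
      N.submatrix (Function.Embedding.subtype (· ∈ W)) (Function.Embedding.subtype (· ∈ W)) := by
    ext i j
    exact h i i.2 j j.2
  rw [← hW, nonsing_map, nonsing_map, hMN]

theorem nonsing_singleton (M : Matrix ι ι (ZMod 2)) (i : ι) : Nonsing M {i} ↔ M i i ≠ 0 := by
  have h := nonsing_map M (⟨![i], Function.injective_of_subsingleton _⟩ : Fin 1 ↪ ι)
  have hW : univ.map (⟨![i], Function.injective_of_subsingleton _⟩ : Fin 1 ↪ ι) = {i} := by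
    ext; simp
  rw [hW, det_fin_one] at h
  simpa using h

theorem nonsing_pair (M : Matrix ι ι (ZMod 2)) {i j : ι} (hij : i ≠ j) :
    Nonsing M {i, j} ↔ M i i * M j j - M i j * M j i ≠ 0 := by
  have hf : Function.Injective ![i, j] := by
    intro a b; fin_cases a <;> fin_cases b <;> simp [hij, hij.symm]
  have h := nonsing_map M (⟨![i, j], hf⟩ : Fin 2 ↪ ι)
  have hW : univ.map (⟨![i, j], hf⟩ : Fin 2 ↪ ι) = {i, j} := by
    ext; simp [Fin.exists_fin_succ, eq_comm]
  rw [hW, det_fin_two] at h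
  simpa using h

theorem nonsing_triple (M : Matrix ι ι (ZMod 2)) {i j k : ι} (hij : i ≠ j) (hik : i ≠ k)
    (hjk : j ≠ k) :
    Nonsing M {i, j, k} ↔ M i i * M j j * M k k - M i i * M j k * M k j - M i j * M j i * M k k
      + M i j * M j k * M k i + M i k * M j i * M k j - M i k * M j j * M k i ≠ 0 := by
  have hf : Function.Injective ![i, j, k] := by
    intro a b
    fin_cases a <;> fin_cases b <;> simp [hij, hik, hjk, hij.symm, hik.symm, hjk.symm]
  have h := nonsing_map M (⟨![i, j, k], hf⟩ : Fin 3 ↪ ι)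
  have hW : univ.map (⟨![i, j, k], hf⟩ : Fin 3 ↪ ι) = {i, j, k} := by
    ext; simp [Fin.exists_fin_succ, eq_comm]
  rw [hW, det_fin_three] at h
  simpa using h

theorem det_alternating_four (a b c d e f : ZMod 2) :
    (!![0, a, b, c; a, 0, d, e; b, d, 0, f; c, e, f, 0]).det = a * f + b * e + c * d := by
  simp [det_succ_row_zero, Fin.sum_univ_succ, Fin.succAbove]
  decide +revert

theorem nonsing_quadruple {M : Matrix ι ι (ZMod 2)} (hM : M.IsSymm) {i j k l : ι} (hij : i ≠ j)
    (hik : i ≠ k) (hil : i ≠ l) (hjk : j ≠ k) (hjl : j ≠ l) (hkl : k ≠ l)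
    (hi : M i i = 0) (hj : M j j = 0) (hk : M k k = 0) (hl : M l l = 0) :
    Nonsing M {i, j, k, l} ↔ M i j * M k l + M i k * M j l + M i l * M j k ≠ 0 := by
  have hf : Function.Injective ![i, j, k, l] := by
    intro a b
    fin_cases a <;> fin_cases b <;> simp [hij, hik, hil, hjk, hjl, hkl, hij.symm, hik.symm,
      hil.symm, hjk.symm, hjl.symm, hkl.symm]
  have hW : univ.map (⟨![i, j, k, l], hf⟩ : Fin 4 ↪ ι) = {i, j, k, l} := by
    ext; simp [Fin.exists_fin_succ, eq_comm]
  have hsub : M.submatrix ![i, j, k, l] ![i, j, k, l] =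
      !![0, M i j, M i k, M i l; M i j, 0, M j k, M j l; M i k, M j k, 0, M k l;
        M i l, M j l, M k l, 0] := by
    ext a b
    fin_cases a <;> fin_cases b <;> simp [hi, hj, hk, hl, hM.apply]
  rw [← hW, nonsing_map, Function.Embedding.coeFn_mk, hsub, det_alternating_four]

/-- Principal pivot transform: if `M[Y]` is nonsingular then twisting by `Y` yields the nonsingular
principal submatrices of another symmetric matrix. -/
theorem exists_pivot {M : Matrix ι ι (ZMod 2)} (hM : M.IsSymm) {Y : Finset ι} (hY : Nonsing M Y) :
    ∃ N : Matrix ι ι (ZMod 2), N.IsSymm ∧ ∀ Z, Nonsing N Z ↔ Nonsing M (symmDiff Y Z) := by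
  classical
  let sel (a b : (ι → ZMod 2) →ₗ[ZMod 2] (ι → ZMod 2)) :
      (ι → ZMod 2) →ₗ[ZMod 2] (ι → ZMod 2) :=
    LinearMap.pi fun i => if i ∈ Y then LinearMap.proj i ∘ₗ a else LinearMap.proj i ∘ₗ b
  have sel_mem : ∀ a b x i, i ∈ Y → sel a b x i = a x i := fun a b x i hi => by simp [sel, hi]
  have sel_not : ∀ a b x i, i ∉ Y → sel a b x i = b x i := fun a b x i hi => by simp [sel, hi]
  let u := sel M.mulVecLin LinearMap.id
  let v := sel LinearMap.id M.mulVecLin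
  have hu : Function.Injective u := by
    rw [← LinearMap.ker_eq_bot, LinearMap.ker_eq_bot']
    intro x hx
    refine hY x (fun i hi => ?_) fun i hi => ?_
    · simpa [u, sel_not _ _ _ _ hi] using congrFun hx i
    · simpa [u, sel_mem _ _ _ _ hi] using congrFun hx i
  let e := LinearEquiv.ofInjectiveEndo u hu
  have he : ∀ x, e x = u x := fun x => rfl
  let N := LinearMap.toMatrix' (v ∘ₗ e.symm.toLinearMap)
  have hN : ∀ x, N *ᵥ (u x) = v x := fun x => by
    rw [← Matrix.toLin'_apply, Matrix.toLin'_toMatrix', ← he]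
    simp
  have hdot : ∀ x y, u x ⬝ᵥ v y = v x ⬝ᵥ u y := by
    intro x y
    have hsymm : x ⬝ᵥ (M *ᵥ y) + (M *ᵥ x) ⬝ᵥ y = 0 := by
      rw [dotProduct_mulVec, ← mulVec_transpose, hM.eq]
      exact CharTwo.add_self_eq_zero _
    rw [← CharTwo.add_eq_zero, ← hsymm]
    simp only [dotProduct, ← sum_add_distrib]
    refine sum_congr rfl fun i _ => ?_
    by_cases hi : i ∈ Y
    · simp [u, v, sel_mem _ _ _ _ hi, add_comm]
    · simp [u, v, sel_not _ _ _ _ hi]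
  refine ⟨N, ?_, fun Z => ?_⟩
  · have key : ∀ a b, a ⬝ᵥ (N *ᵥ b) = (N *ᵥ a) ⬝ᵥ b := by
      intro a b
      obtain ⟨x, rfl⟩ := e.surjective a
      obtain ⟨y, rfl⟩ := e.surjective b
      simp only [he, hN, hdot]
    ext i j
    have := key (Pi.single j 1) (Pi.single i 1)
    simpa using this
  · have step : ∀ x, ((∀ i ∉ Z, u x i = 0) ∧ ∀ i ∈ Z, v x i = 0) ↔
        (∀ i ∉ symmDiff Y Z, x i = 0) ∧ ∀ i ∈ symmDiff Y Z, (M *ᵥ x) i = 0 := by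
      intro x
      simp only [← forall_and]
      refine forall_congr' fun i => ?_
      by_cases hi : i ∈ Y <;> by_cases hz : i ∈ Z <;>
        simp [mem_symmDiff, hi, hz, u, v, sel_mem _ _ _ _, sel_not _ _ _ _]
    have hu0 : ∀ x, u x = 0 ↔ x = 0 := fun x => map_eq_zero_iff u hu
    constructor
    · intro h x hx hMx
      obtain ⟨h1, h2⟩ := (step x).2 ⟨hx, hMx⟩
      exact (hu0 x).1 (h _ h1 fun i hi => by rw [hN, h2 i hi])
    · intro h y hy hNy
      obtain ⟨x, rfl⟩ := e.surjective y
      rw [he] at hy hNy ⊢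
      rw [hN] at hNy
      obtain ⟨h1, h2⟩ := (step x).1 ⟨hy, hNy⟩
      exact (hu0 x).2 (h x h1 h2)

/-- A symmetric matrix over GF(2) is determined by its principal minors of order at most two. -/
theorem entry_eq_of_nonsing_iff {M N : Matrix ι ι (ZMod 2)} (hM : M.IsSymm) (hN : N.IsSymm)
    {W : Finset ι} (h : ∀ Z ⊆ W, #Z ≤ 2 → (Nonsing M Z ↔ Nonsing N Z)) :
    ∀ i ∈ W, ∀ j ∈ W, M i j = N i j := by
  have hdiag : ∀ i ∈ W, M i i = N i i := fun i hi => by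
    have := h {i} (by simpa using hi) (by simp)
    rw [nonsing_singleton, nonsing_singleton] at this
    generalize M i i = a, N i i = b at *
    revert a b
    decide
  intro i hi j hj
  obtain rfl | hij := eq_or_ne i j
  · exact hdiag i hi
  have := h {i, j} (by simp [insert_subset_iff, hi, hj]) card_le_two
  rw [nonsing_pair _ hij, nonsing_pair _ hij, hM.apply i j, hN.apply i j, hdiag i hi,
    hdiag j hj] at this
  generalize N i i = a, N j j = b, M i j = c, N i j = d at *
  revert a b c d
  decide

end Nonsingular

section Cubes

/-- A family of subsets of a three-element set, containing the empty set, as a function of the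
membership bits. -/
def cube₃ (p₁ p₂ p₃ p₁₂ p₁₃ p₂₃ p₁₂₃ x y z : Bool) : Bool :=
  bif x then (bif y then (bif z then p₁₂₃ else p₁₂) else (bif z then p₁₃ else p₁))
  else (bif y then (bif z then p₂₃ else p₂) else (bif z then p₃ else true))

/-- The exchange axiom for the first of three elements. -/
def Exch₃ (p : Bool → Bool → Bool → Bool) : Prop :=
  ∀ x y z, p x y z = true → ∀ y' z', p (!x) y' z' = true →
    p (!x) y z = true ∨ (y ≠ y' ∧ p (!x) (!y) z = true) ∨ (z ≠ z' ∧ p (!x) y (!z) = true)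

instance (p : Bool → Bool → Bool → Bool) : Decidable (Exch₃ p) := by
  unfold Exch₃; infer_instance

/-- No twist of `p` by one of its members equals `s`. -/
def Avoids₃ (s p : Bool → Bool → Bool → Bool) : Prop :=
  ∀ a b c, p a b c = true → ∃ x y z, p (a ^^ x) (b ^^ y) (c ^^ z) ≠ s x y z

instance (s p : Bool → Bool → Bool → Bool) : Decidable (Avoids₃ s p) := by
  unfold Avoids₃; infer_instance

/-- The cube of `S₁`. -/
def cubeS₁ : Bool → Bool → Bool → Bool := cube₃ false false false true true true true

/-- The cube of `S₂`. -/
def cubeS₂ : Bool → Bool → Bool → Bool := cube₃ true true true true true true false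

/-- The cube of `S₃`. -/
def cubeS₃ : Bool → Bool → Bool → Bool := cube₃ false true true true true false true

theorem cube₃_top_eq : ∀ p₁ p₂ p₃ p₁₂ p₁₃ p₂₃ p₁₂₃ : Bool,
    let p := cube₃ p₁ p₂ p₃ p₁₂ p₁₃ p₂₃ p₁₂₃
    Exch₃ p → Exch₃ (fun y x z => p x y z) → Exch₃ (fun z x y => p x y z) →
    Avoids₃ cubeS₁ p → Avoids₃ cubeS₂ p → Avoids₃ cubeS₃ p →
    Avoids₃ cubeS₃ (fun y x z => p x y z) → Avoids₃ cubeS₃ (fun z x y => p x y z) →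
    p₁₂₃ = ((p₁ && p₂ && p₃) ^^ (p₁ && (p₂₃ ^^ (p₂ && p₃))) ^^ (p₂ && (p₁₃ ^^ (p₁ && p₃)))
      ^^ (p₃ && (p₁₂ ^^ (p₁ && p₂)))) := by
  decide +kernel

theorem eq_cube₃ {p : Bool → Bool → Bool → Bool} (h : p false false false = true) :
    p = cube₃ (p true false false) (p false true false) (p false false true)
      (p true true false) (p true false true) (p false true true) (p true true true) := by
  funext x y z
  cases x <;> cases y <;> cases z <;> simp [cube₃, h]

/-- A family of subsets of a four-element set, containing the empty set and no set of odd size, as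
a function of the membership bits. -/
def cube₄ (e₁₂ e₁₃ e₁₄ e₂₃ e₂₄ e₃₄ q w x y z : Bool) : Bool :=
  bif w then (bif x then (bif y then z && q else !z && e₁₂)
    else (bif y then !z && e₁₃ else z && e₁₄))
  else (bif x then (bif y then !z && e₂₃ else z && e₂₄) else (bif y then z && e₃₄ else !z))

/-- The exchange axiom for the first of four elements. -/
def Exch₄ (p : Bool → Bool → Bool → Bool → Bool) : Prop :=
  ∀ w x y z, p w x y z = true → ∀ x' y' z', p (!w) x' y' z' = true →
    p (!w) x y z = true ∨ (x ≠ x' ∧ p (!w) (!x) y z = true) ∨ (y ≠ y' ∧ p (!w) x (!y) z = true) ∨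
      (z ≠ z' ∧ p (!w) x y (!z) = true)

set_option synthInstance.maxHeartbeats 400000 in
set_option synthInstance.maxSize 1000 in
instance (p : Bool → Bool → Bool → Bool → Bool) : Decidable (Exch₄ p) := by
  unfold Exch₄; infer_instance

/-- No twist of `p` by one of its members equals `s`. -/
def Avoids₄ (s p : Bool → Bool → Bool → Bool → Bool) : Prop :=
  ∀ a b c d, p a b c d = true → ∃ w x y z, p (a ^^ w) (b ^^ x) (c ^^ y) (d ^^ z) ≠ s w x y z

instance (s p : Bool → Bool → Bool → Bool → Bool) : Decidable (Avoids₄ s p) := by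
  unfold Avoids₄; infer_instance

/-- The cube of `S₄`. -/
def cubeS₄ : Bool → Bool → Bool → Bool → Bool := cube₄ true true true true true true false

/-- The cube of `S₅`. -/
def cubeS₅ : Bool → Bool → Bool → Bool → Bool := cube₄ true false true true false true true

theorem cube₄_top_eq : ∀ e₁₂ e₁₃ e₁₄ e₂₃ e₂₄ e₃₄ q : Bool,
    let p := cube₄ e₁₂ e₁₃ e₁₄ e₂₃ e₂₄ e₃₄ q
    Exch₄ p → Exch₄ (fun x w y z => p w x y z) → Exch₄ (fun y w x z => p w x y z) →
    Exch₄ (fun z w x y => p w x y z) → Avoids₄ cubeS₄ p → Avoids₄ cubeS₅ p →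
    Avoids₄ cubeS₅ (fun w y x z => p w x y z) → Avoids₄ cubeS₅ (fun w x z y => p w x y z) →
    q = ((e₁₂ && e₃₄) ^^ (e₁₃ && e₂₄) ^^ (e₁₄ && e₂₃)) := by
  decide +kernel

theorem eq_cube₄ {p : Bool → Bool → Bool → Bool → Bool} (h : p false false false false = true)
    (h₁ : p true false false false = false) (h₂ : p false true false false = false)
    (h₃ : p false false true false = false) (h₄ : p false false false true = false)
    (h₂₃₄ : p false true true true = false) (h₁₃₄ : p true false true true = false)
    (h₁₂₄ : p true true false true = false) (h₁₂₃ : p true true true false = false) :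
    p = cube₄ (p true true false false) (p true false true false) (p true false false true)
      (p false true true false) (p false true false true) (p false false true true)
      (p true true true true) := by
  funext w x y z
  cases w <;> cases x <;> cases y <;> cases z <;> simp [cube₄, *]

end Cubes

section Families

variable {ι : Type*}

/-- The set which is `{i}` or empty. -/
def cell (x : Bool) (i : ι) : Finset ι := if x then {i} else ∅

theorem mem_cell {x : Bool} {i a : ι} : a ∈ cell x i ↔ x = true ∧ a = i := by
  cases x <;> simp [cell]

theorem image_cell {κ : Type*} [DecidableEq κ] (φ : ι → κ) (x : Bool) (i : ι) :
    (cell x i).image φ = cell x (φ i) := by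
  cases x <;> simp [cell]

variable [DecidableEq ι]

/-- The symmetric exchange axiom. -/
def Exchange (𝓕 : Set (Finset ι)) : Prop :=
  ∀ F₁ ∈ 𝓕, ∀ F₂ ∈ 𝓕, ∀ x ∈ symmDiff F₁ F₂, ∃ y ∈ symmDiff F₁ F₂, symmDiff F₁ {x, y} ∈ 𝓕

/-- No restriction of a twist of `𝓕` by one of its members is isomorphic to `S`. -/
def Excludes (𝓕 : Set (Finset ι)) (S : SetSystem ℕ) : Prop :=
  ∀ F ∈ 𝓕, ∀ (X : Finset ι) (φ : ι → ℕ), Set.InjOn φ X → X.image φ = S.E →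
    ¬ ∀ W ⊆ X, (symmDiff F W ∈ 𝓕 ↔ W.image φ ∈ S.F)

/-- The subset of `{i, j, k}` with the given membership bits. -/
def span₃ (i j k : ι) (x y z : Bool) : Finset ι := cell x i ∪ cell y j ∪ cell z k

/-- The subset of `{i, j, k, l}` with the given membership bits. -/
def span₄ (i j k l : ι) (w x y z : Bool) : Finset ι := cell w i ∪ cell x j ∪ cell y k ∪ cell z l

theorem mem_span₃ {i j k a : ι} {x y z : Bool} :
    a ∈ span₃ i j k x y z ↔ (x = true ∧ a = i) ∨ (y = true ∧ a = j) ∨ (z = true ∧ a = k) := by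
  simp [span₃, mem_cell]

theorem mem_span₄ {i j k l a : ι} {w x y z : Bool} :
    a ∈ span₄ i j k l w x y z ↔
      (w = true ∧ a = i) ∨ (x = true ∧ a = j) ∨ (y = true ∧ a = k) ∨ (z = true ∧ a = l) := by
  simp [span₄, mem_cell]

theorem symmDiff_span₃ {i j k : ι} (hij : i ≠ j) (hik : i ≠ k) (hjk : j ≠ k)
    (x y z x' y' z' : Bool) :
    symmDiff (span₃ i j k x y z) (span₃ i j k x' y' z') =
      span₃ i j k (x ^^ x') (y ^^ y') (z ^^ z') := by
  ext a
  by_cases hi : a = i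
  · subst hi; cases x <;> cases x' <;> simp [mem_symmDiff, mem_span₃, *]
  by_cases hj : a = j
  · subst hj; cases y <;> cases y' <;> simp [mem_symmDiff, mem_span₃, *]
  by_cases hk : a = k
  · subst hk; cases z <;> cases z' <;> simp [mem_symmDiff, mem_span₃, *]
  simp [mem_symmDiff, mem_span₃, *]

theorem symmDiff_span₄ {i j k l : ι} (hij : i ≠ j) (hik : i ≠ k) (hil : i ≠ l) (hjk : j ≠ k)
    (hjl : j ≠ l) (hkl : k ≠ l) (w x y z w' x' y' z' : Bool) :
    symmDiff (span₄ i j k l w x y z) (span₄ i j k l w' x' y' z') =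
      span₄ i j k l (w ^^ w') (x ^^ x') (y ^^ y') (z ^^ z') := by
  ext a
  by_cases hi : a = i
  · subst hi; cases w <;> cases w' <;> simp [mem_symmDiff, mem_span₄, *]
  by_cases hj : a = j
  · subst hj; cases x <;> cases x' <;> simp [mem_symmDiff, mem_span₄, *]
  by_cases hk : a = k
  · subst hk; cases y <;> cases y' <;> simp [mem_symmDiff, mem_span₄, *]
  by_cases hl : a = l
  · subst hl; cases z <;> cases z' <;> simp [mem_symmDiff, mem_span₄, *]
  simp [mem_symmDiff, mem_span₄, *]

open Classical in
/-- The twist of `𝓕` by `F`, restricted to `{i, j, k}`. -/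
noncomputable def ind₃ (𝓕 : Set (Finset ι)) (F : Finset ι) (i j k : ι) (x y z : Bool) : Bool :=
  decide (symmDiff F (span₃ i j k x y z) ∈ 𝓕)

open Classical in
/-- The twist of `𝓕` by `F`, restricted to `{i, j, k, l}`. -/
noncomputable def ind₄ (𝓕 : Set (Finset ι)) (F : Finset ι) (i j k l : ι) (w x y z : Bool) : Bool :=
  decide (symmDiff F (span₄ i j k l w x y z) ∈ 𝓕)

variable {𝓕 : Set (Finset ι)} {F : Finset ι} {i j k l : ι}

theorem ind₃_eq_true {x y z : Bool} :
    ind₃ 𝓕 F i j k x y z = true ↔ symmDiff F (span₃ i j k x y z) ∈ 𝓕 := by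
  simp [ind₃]

theorem ind₄_eq_true {w x y z : Bool} :
    ind₄ 𝓕 F i j k l w x y z = true ↔ symmDiff F (span₄ i j k l w x y z) ∈ 𝓕 := by
  simp [ind₄]

theorem Excludes.avoids₃ {S : SetSystem ℕ} (h : Excludes 𝓕 S) (hE : S.E = {1, 2, 3})
    {s : Bool → Bool → Bool → Bool} (hs : ∀ x y z, span₃ 1 2 3 x y z ∈ S.F ↔ s x y z = true)
    (hij : i ≠ j) (hik : i ≠ k) (hjk : j ≠ k) : Avoids₃ s (ind₃ 𝓕 F i j k) := by
  intro a b c hp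
  by_contra! hall
  let φ : ι → ℕ := fun t => if t = i then 1 else if t = j then 2 else 3
  have hφi : φ i = 1 := by simp [φ]
  have hφj : φ j = 2 := by simp [φ, hij.symm]
  have hφk : φ k = 3 := by simp [φ, hik.symm, hjk.symm]
  refine h _ (ind₃_eq_true.1 hp) {i, j, k} φ ?_ (by simp [image_insert, hφi, hφj, hφk, hE]) ?_
  · intro u hu v hv
    simp only [coe_insert, coe_singleton, Set.mem_insert_iff, Set.mem_singleton_iff] at hu hv
    rcases hu with rfl | rfl | rfl <;> rcases hv with rfl | rfl | rfl <;> simp [hφi, hφj, hφk]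
  · intro W hW
    have hspan : W = span₃ i j k (decide (i ∈ W)) (decide (j ∈ W)) (decide (k ∈ W)) := by
      ext t
      have := @hW t
      simp only [mem_insert, mem_singleton] at this
      simp only [mem_span₃, decide_eq_true_eq]
      grind
    generalize decide (i ∈ W) = x, decide (j ∈ W) = y, decide (k ∈ W) = z at hspan
    subst hspan
    rw [symmDiff_assoc, symmDiff_span₃ hij hik hjk, ← ind₃_eq_true, hall, ← hs]
    simp [span₃, image_union, image_cell, hφi, hφj, hφk]

theorem Excludes.avoids₄ {S : SetSystem ℕ} (h : Excludes 𝓕 S) (hE : S.E = {1, 2, 3, 4})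
    {s : Bool → Bool → Bool → Bool → Bool}
    (hs : ∀ w x y z, span₄ 1 2 3 4 w x y z ∈ S.F ↔ s w x y z = true)
    (hij : i ≠ j) (hik : i ≠ k) (hil : i ≠ l) (hjk : j ≠ k) (hjl : j ≠ l) (hkl : k ≠ l) :
    Avoids₄ s (ind₄ 𝓕 F i j k l) := by
  intro a b c d hp
  by_contra! hall
  let φ : ι → ℕ := fun t => if t = i then 1 else if t = j then 2 else if t = k then 3 else 4
  have hφi : φ i = 1 := by simp [φ]
  have hφj : φ j = 2 := by simp [φ, hij.symm]
  have hφk : φ k = 3 := by simp [φ, hik.symm, hjk.symm]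
  have hφl : φ l = 4 := by simp [φ, hil.symm, hjl.symm, hkl.symm]
  refine h _ (ind₄_eq_true.1 hp) {i, j, k, l} φ ?_
    (by simp [image_insert, hφi, hφj, hφk, hφl, hE]) ?_
  · intro u hu v hv
    simp only [coe_insert, coe_singleton, Set.mem_insert_iff, Set.mem_singleton_iff] at hu hv
    rcases hu with rfl | rfl | rfl | rfl <;> rcases hv with rfl | rfl | rfl | rfl <;>
      simp [hφi, hφj, hφk, hφl]
  · intro W hW
    have hspan : W = span₄ i j k l (decide (i ∈ W)) (decide (j ∈ W)) (decide (k ∈ W))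
        (decide (l ∈ W)) := by
      ext t
      have := @hW t
      simp only [mem_insert, mem_singleton] at this
      simp only [mem_span₄, decide_eq_true_eq]
      grind
    generalize decide (i ∈ W) = w, decide (j ∈ W) = x, decide (k ∈ W) = y,
      decide (l ∈ W) = z at hspan
    subst hspan
    rw [symmDiff_assoc, symmDiff_span₄ hij hik hil hjk hjl hkl, ← ind₄_eq_true, hall, ← hs]
    simp [span₄, image_union, image_cell, hφi, hφj, hφk, hφl]

theorem Exchange.exch₃ (h : Exchange 𝓕) (hij : i ≠ j) (hik : i ≠ k) (hjk : j ≠ k) :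
    Exch₃ (ind₃ 𝓕 F i j k) := by
  intro x y z hp y' z' hp'
  rw [ind₃_eq_true] at hp hp'
  have hd : symmDiff (symmDiff F (span₃ i j k x y z)) (symmDiff F (span₃ i j k (!x) y' z')) =
      span₃ i j k true (y ^^ y') (z ^^ z') := by
    rw [symmDiff_symmDiff_symmDiff_comm, symmDiff_self, bot_symmDiff, symmDiff_span₃ hij hik hjk]
    simp
  obtain ⟨t, ht, hmem⟩ := h _ hp _ hp' i (by rw [hd, mem_span₃]; simp)
  rw [hd, mem_span₃] at ht
  rw [symmDiff_assoc] at hmem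
  simp only [ind₃_eq_true]
  rcases ht with ⟨-, rfl⟩ | ⟨hy, rfl⟩ | ⟨hz, rfl⟩
  · left
    have : ({t, t} : Finset ι) = span₃ t j k true false false := by simp [span₃, cell]
    rw [this, symmDiff_span₃ hij hik hjk] at hmem
    simpa using hmem
  · right; left
    have : ({i, t} : Finset ι) = span₃ i t k true true false := by simp [span₃, cell]
    rw [this, symmDiff_span₃ hij hik hjk] at hmem
    simpa using And.intro (bne_iff_ne.1 hy) hmem
  · right; right
    have : ({i, t} : Finset ι) = span₃ i j t true false true := by simp [span₃, cell]
    rw [this, symmDiff_span₃ hij hik hjk] at hmem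
    simpa using And.intro (bne_iff_ne.1 hz) hmem

theorem Exchange.exch₄ (h : Exchange 𝓕) (hij : i ≠ j) (hik : i ≠ k) (hil : i ≠ l) (hjk : j ≠ k)
    (hjl : j ≠ l) (hkl : k ≠ l) : Exch₄ (ind₄ 𝓕 F i j k l) := by
  intro w x y z hp x' y' z' hp'
  rw [ind₄_eq_true] at hp hp'
  have hd : symmDiff (symmDiff F (span₄ i j k l w x y z))
      (symmDiff F (span₄ i j k l (!w) x' y' z')) =
      span₄ i j k l true (x ^^ x') (y ^^ y') (z ^^ z') := by
    rw [symmDiff_symmDiff_symmDiff_comm, symmDiff_self, bot_symmDiff,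
      symmDiff_span₄ hij hik hil hjk hjl hkl]
    simp
  obtain ⟨t, ht, hmem⟩ := h _ hp _ hp' i (by rw [hd, mem_span₄]; simp)
  rw [hd, mem_span₄] at ht
  rw [symmDiff_assoc] at hmem
  simp only [ind₄_eq_true]
  rcases ht with ⟨-, rfl⟩ | ⟨hx, rfl⟩ | ⟨hy, rfl⟩ | ⟨hz, rfl⟩
  · left
    have : ({t, t} : Finset ι) = span₄ t j k l true false false false := by simp [span₄, cell]
    rw [this, symmDiff_span₄ hij hik hil hjk hjl hkl] at hmem
    simpa using hmem
  · right; left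
    have : ({i, t} : Finset ι) = span₄ i t k l true true false false := by simp [span₄, cell]
    rw [this, symmDiff_span₄ hij hik hil hjk hjl hkl] at hmem
    simpa using And.intro (bne_iff_ne.1 hx) hmem
  · right; right; left
    have : ({i, t} : Finset ι) = span₄ i j t l true false true false := by simp [span₄, cell]
    rw [this, symmDiff_span₄ hij hik hil hjk hjl hkl] at hmem
    simpa using And.intro (bne_iff_ne.1 hy) hmem
  · right; right; right
    have : ({i, t} : Finset ι) = span₄ i j k t true false false true := by simp [span₄, cell]
    rw [this, symmDiff_span₄ hij hik hil hjk hjl hkl] at hmem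
    simpa using And.intro (bne_iff_ne.1 hz) hmem

theorem ind₃_top_eq (hexch : Exchange 𝓕) (h₁ : Excludes 𝓕 S₁) (h₂ : Excludes 𝓕 S₂)
    (h₃ : Excludes 𝓕 S₃) (hF : F ∈ 𝓕) (hij : i ≠ j) (hik : i ≠ k) (hjk : j ≠ k) :
    let p := ind₃ 𝓕 F i j k
    p true true true =
      ((p true false false && p false true false && p false false true) ^^
        (p true false false && (p false true true ^^ (p false true false && p false false true))) ^^
        (p false true false && (p true false true ^^ (p true false false && p false false true))) ^^
        (p false false true &&
          (p true true false ^^ (p true false false && p false true false)))) := by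
  have hp := eq_cube₃ (p := ind₃ 𝓕 F i j k)
    (ind₃_eq_true.2 (by simpa [span₃, cell, ← bot_eq_empty] using hF))
  have e₂ : (fun y x z => ind₃ 𝓕 F i j k x y z) = ind₃ 𝓕 F j i k := by
    funext y x z
    have : span₃ i j k x y z = span₃ j i k y x z := by
      ext; simp only [mem_span₃]; tauto
    rw [Bool.eq_iff_iff, ind₃_eq_true, ind₃_eq_true, this]
  have e₃ : (fun z x y => ind₃ 𝓕 F i j k x y z) = ind₃ 𝓕 F k i j := by
    funext z x y
    have : span₃ i j k x y z = span₃ k i j z x y := by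
      ext; simp only [mem_span₃]; tauto
    rw [Bool.eq_iff_iff, ind₃_eq_true, ind₃_eq_true, this]
  have hs₁ : ∀ x y z, span₃ 1 2 3 x y z ∈ S₁.F ↔ cubeS₁ x y z = true := by
    simp only [S₁, Set.mem_insert_iff, Set.mem_singleton_iff]; decide
  have hs₂ : ∀ x y z, span₃ 1 2 3 x y z ∈ S₂.F ↔ cubeS₂ x y z = true := by
    simp only [S₂, Set.mem_insert_iff, Set.mem_singleton_iff]; decide
  have hs₃ : ∀ x y z, span₃ 1 2 3 x y z ∈ S₃.F ↔ cubeS₃ x y z = true := by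
    simp only [S₃, Set.mem_insert_iff, Set.mem_singleton_iff]; decide
  refine cube₃_top_eq (ind₃ 𝓕 F i j k true false false) (ind₃ 𝓕 F i j k false true false)
    (ind₃ 𝓕 F i j k false false true) (ind₃ 𝓕 F i j k true true false)
    (ind₃ 𝓕 F i j k true false true) (ind₃ 𝓕 F i j k false true true)
    (ind₃ 𝓕 F i j k true true true) ?_ ?_ ?_ ?_ ?_ ?_ ?_ ?_ <;> rw [← hp]
  · exact hexch.exch₃ hij hik hjk
  · rw [e₂]; exact hexch.exch₃ hij.symm hjk hik
  · rw [e₃]; exact hexch.exch₃ hik.symm hjk.symm hij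
  · exact h₁.avoids₃ rfl hs₁ hij hik hjk
  · exact h₂.avoids₃ rfl hs₂ hij hik hjk
  · exact h₃.avoids₃ rfl hs₃ hij hik hjk
  · rw [e₂]; exact h₃.avoids₃ rfl hs₃ hij.symm hjk hik
  · rw [e₃]; exact h₃.avoids₃ rfl hs₃ hik.symm hjk.symm hij

theorem ind₄_top_eq (hexch : Exchange 𝓕) (h₄ : Excludes 𝓕 S₄) (h₅ : Excludes 𝓕 S₅) (hF : F ∈ 𝓕)
    (hij : i ≠ j) (hik : i ≠ k) (hil : i ≠ l) (hjk : j ≠ k) (hjl : j ≠ l) (hkl : k ≠ l)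
    (hodd : ∀ W ⊆ {i, j, k, l}, #W = 1 ∨ #W = 3 → symmDiff F W ∉ 𝓕) :
    let p := ind₄ 𝓕 F i j k l
    p true true true true =
      ((p true true false false && p false false true true) ^^
        (p true false true false && p false true false true) ^^
        (p true false false true && p false true true false)) := by
  have hodd' : ∀ w x y z, (w ^^ x ^^ y ^^ z) = true → ind₄ 𝓕 F i j k l w x y z = false := by
    intro w x y z hw
    rw [Bool.eq_false_iff, Ne, ind₄_eq_true]
    refine hodd _ (fun a => by simp only [mem_span₄, mem_insert, mem_singleton]; tauto) ?_
    revert hw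
    cases w <;> cases x <;> cases y <;> cases z <;> simp [span₄, cell, *]
  have hp := eq_cube₄ (p := ind₄ 𝓕 F i j k l)
    (ind₄_eq_true.2 (by simpa [span₄, cell, ← bot_eq_empty] using hF))
    (hodd' _ _ _ _ rfl) (hodd' _ _ _ _ rfl) (hodd' _ _ _ _ rfl) (hodd' _ _ _ _ rfl)
    (hodd' _ _ _ _ rfl) (hodd' _ _ _ _ rfl) (hodd' _ _ _ _ rfl) (hodd' _ _ _ _ rfl)
  have e₂ : (fun x w y z => ind₄ 𝓕 F i j k l w x y z) = ind₄ 𝓕 F j i k l := by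
    funext x w y z
    have : span₄ i j k l w x y z = span₄ j i k l x w y z := by
      ext; simp only [mem_span₄]; tauto
    rw [Bool.eq_iff_iff, ind₄_eq_true, ind₄_eq_true, this]
  have e₃ : (fun y w x z => ind₄ 𝓕 F i j k l w x y z) = ind₄ 𝓕 F k i j l := by
    funext y w x z
    have : span₄ i j k l w x y z = span₄ k i j l y w x z := by
      ext; simp only [mem_span₄]; tauto
    rw [Bool.eq_iff_iff, ind₄_eq_true, ind₄_eq_true, this]
  have e₄ : (fun z w x y => ind₄ 𝓕 F i j k l w x y z) = ind₄ 𝓕 F l i j k := by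
    funext z w x y
    have : span₄ i j k l w x y z = span₄ l i j k z w x y := by
      ext; simp only [mem_span₄]; tauto
    rw [Bool.eq_iff_iff, ind₄_eq_true, ind₄_eq_true, this]
  have e₂₃ : (fun w y x z => ind₄ 𝓕 F i j k l w x y z) = ind₄ 𝓕 F i k j l := by
    funext w y x z
    have : span₄ i j k l w x y z = span₄ i k j l w y x z := by
      ext; simp only [mem_span₄]; tauto
    rw [Bool.eq_iff_iff, ind₄_eq_true, ind₄_eq_true, this]
  have e₃₄ : (fun w x z y => ind₄ 𝓕 F i j k l w x y z) = ind₄ 𝓕 F i j l k := by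
    funext w x z y
    have : span₄ i j k l w x y z = span₄ i j l k w x z y := by
      ext; simp only [mem_span₄]; tauto
    rw [Bool.eq_iff_iff, ind₄_eq_true, ind₄_eq_true, this]
  have hs₄ : ∀ w x y z, span₄ 1 2 3 4 w x y z ∈ S₄.F ↔ cubeS₄ w x y z = true := by
    simp only [S₄, Set.mem_insert_iff, Set.mem_singleton_iff]; decide
  have hs₅ : ∀ w x y z, span₄ 1 2 3 4 w x y z ∈ S₅.F ↔ cubeS₅ w x y z = true := by
    simp only [S₅, Set.mem_insert_iff, Set.mem_singleton_iff]; decide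
  refine cube₄_top_eq (ind₄ 𝓕 F i j k l true true false false)
    (ind₄ 𝓕 F i j k l true false true false) (ind₄ 𝓕 F i j k l true false false true)
    (ind₄ 𝓕 F i j k l false true true false) (ind₄ 𝓕 F i j k l false true false true)
    (ind₄ 𝓕 F i j k l false false true true) (ind₄ 𝓕 F i j k l true true true true)
    ?_ ?_ ?_ ?_ ?_ ?_ ?_ ?_ <;> rw [← hp]
  · exact hexch.exch₄ hij hik hil hjk hjl hkl
  · rw [e₂]; exact hexch.exch₄ hij.symm hjk hjl hik hil hkl
  · rw [e₃]; exact hexch.exch₄ hik.symm hjk.symm hkl hij hil hjl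
  · rw [e₄]; exact hexch.exch₄ hil.symm hjl.symm hkl.symm hij hik hjk
  · exact h₄.avoids₄ rfl hs₄ hij hik hil hjk hjl hkl
  · exact h₅.avoids₄ rfl hs₅ hij hik hil hjk hjl hkl
  · rw [e₂₃]; exact h₅.avoids₄ rfl hs₅ hik hij hil hjk.symm hkl hjl
  · rw [e₃₄]; exact h₅.avoids₄ rfl hs₅ hij hil hik hjl hjk hkl.symm

/-- A bit as an element of GF(2). -/
def toGF2 (b : Bool) : ZMod 2 := if b then 1 else 0

open Classical in
/-- The only symmetric matrix whose nonsingular principal submatrices of order at most two can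
describe the twist of `𝓕` by `F`. -/
noncomputable def fund (𝓕 : Set (Finset ι)) (F : Finset ι) : Matrix ι ι (ZMod 2) :=
  Matrix.of fun i j =>
    if i = j then toGF2 (decide (symmDiff F {i} ∈ 𝓕))
    else toGF2 (decide (symmDiff F {i, j} ∈ 𝓕)) +
      toGF2 (decide (symmDiff F {i} ∈ 𝓕)) * toGF2 (decide (symmDiff F {j} ∈ 𝓕))

open Classical in
theorem fund_self (𝓕 : Set (Finset ι)) (F : Finset ι) (i : ι) :
    fund 𝓕 F i i = toGF2 (decide (symmDiff F {i} ∈ 𝓕)) := by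
  simp [fund]

open Classical in
theorem fund_ne (𝓕 : Set (Finset ι)) (F : Finset ι) (hij : i ≠ j) :
    fund 𝓕 F i j = toGF2 (decide (symmDiff F {i, j} ∈ 𝓕)) +
      toGF2 (decide (symmDiff F {i} ∈ 𝓕)) * toGF2 (decide (symmDiff F {j} ∈ 𝓕)) := by
  simp [fund, hij]

theorem fund_isSymm (𝓕 : Set (Finset ι)) (F : Finset ι) : (fund 𝓕 F).IsSymm := by
  ext i j
  obtain rfl | hij := eq_or_ne i j
  · rfl
  · rw [transpose_apply, fund_ne _ _ hij, fund_ne _ _ hij.symm, pair_comm, mul_comm]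

variable [Fintype ι]

theorem mem_iff_nonsing_fund_of_card_le_two (hF : F ∈ 𝓕) {W : Finset ι} (hW : #W ≤ 2) :
    symmDiff F W ∈ 𝓕 ↔ Nonsing (fund 𝓕 F) W := by
  classical
  interval_cases h : #W
  · rw [card_eq_zero.1 h]
    exact iff_of_true (by simpa [← bot_eq_empty] using hF) (nonsing_empty _)
  · obtain ⟨i, rfl⟩ := card_eq_one.1 h
    refine decide_eq_true_iff.symm.trans ?_
    rw [nonsing_singleton, fund_self]
    generalize decide (symmDiff F {i} ∈ 𝓕) = a
    revert a
    decide
  · obtain ⟨i, j, hij, rfl⟩ := card_eq_two.1 h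
    refine decide_eq_true_iff.symm.trans ?_
    rw [nonsing_pair _ hij, (fund_isSymm 𝓕 F).apply i j, fund_ne _ _ hij, fund_self, fund_self]
    generalize decide (symmDiff F {i} ∈ 𝓕) = a, decide (symmDiff F {j} ∈ 𝓕) = b,
      decide (symmDiff F {i, j} ∈ 𝓕) = c
    revert a b c
    decide

theorem mem_iff_nonsing_fund_triple (hexch : Exchange 𝓕) (h₁ : Excludes 𝓕 S₁)
    (h₂ : Excludes 𝓕 S₂) (h₃ : Excludes 𝓕 S₃) (hF : F ∈ 𝓕) (hij : i ≠ j) (hik : i ≠ k)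
    (hjk : j ≠ k) : symmDiff F {i, j, k} ∈ 𝓕 ↔ Nonsing (fund 𝓕 F) {i, j, k} := by
  classical
  have hp : ∀ (x y z : Bool) {W : Finset ι}, span₃ i j k x y z = W →
      ind₃ 𝓕 F i j k x y z = decide (symmDiff F W ∈ 𝓕) := by
    rintro x y z _ rfl
    rw [Bool.eq_iff_iff, ind₃_eq_true, decide_eq_true_iff]
  have htop := ind₃_top_eq hexch h₁ h₂ h₃ hF hij hik hjk
  dsimp only at htop
  rw [hp true false false (W := {i}) (by simp [span₃, cell]),
    hp false true false (W := {j}) (by simp [span₃, cell]),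
    hp false false true (W := {k}) (by simp [span₃, cell]),
    hp true true false (W := {i, j}) (by simp [span₃, cell]),
    hp true false true (W := {i, k}) (by simp [span₃, cell]),
    hp false true true (W := {j, k}) (by simp [span₃, cell]),
    hp true true true (W := {i, j, k}) (by simp [span₃, cell])] at htop
  refine decide_eq_true_iff.symm.trans ?_
  rw [nonsing_triple _ hij hik hjk, (fund_isSymm 𝓕 F).apply i j, (fund_isSymm 𝓕 F).apply i k,
    (fund_isSymm 𝓕 F).apply j k, fund_ne _ _ hij, fund_ne _ _ hik, fund_ne _ _ hjk, fund_self,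
    fund_self, fund_self, htop]
  generalize decide (symmDiff F {i} ∈ 𝓕) = a, decide (symmDiff F {j} ∈ 𝓕) = b,
    decide (symmDiff F {k} ∈ 𝓕) = c, decide (symmDiff F {i, j} ∈ 𝓕) = d,
    decide (symmDiff F {i, k} ∈ 𝓕) = e, decide (symmDiff F {j, k} ∈ 𝓕) = f
  revert a b c d e f
  decide +kernel

theorem mem_iff_nonsing_fund_quadruple (hexch : Exchange 𝓕) (h₄ : Excludes 𝓕 S₄)
    (h₅ : Excludes 𝓕 S₅) (hF : F ∈ 𝓕) (hij : i ≠ j) (hik : i ≠ k) (hil : i ≠ l) (hjk : j ≠ k)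
    (hjl : j ≠ l) (hkl : k ≠ l)
    (hodd : ∀ W ⊆ {i, j, k, l}, #W = 1 ∨ #W = 3 → symmDiff F W ∉ 𝓕) :
    symmDiff F {i, j, k, l} ∈ 𝓕 ↔ Nonsing (fund 𝓕 F) {i, j, k, l} := by
  classical
  have hp : ∀ (w x y z : Bool) {W : Finset ι}, span₄ i j k l w x y z = W →
      ind₄ 𝓕 F i j k l w x y z = decide (symmDiff F W ∈ 𝓕) := by
    rintro w x y z _ rfl
    rw [Bool.eq_iff_iff, ind₄_eq_true, decide_eq_true_iff]
  have htop := ind₄_top_eq hexch h₄ h₅ hF hij hik hil hjk hjl hkl hodd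
  dsimp only at htop
  rw [hp true true false false (W := {i, j}) (by simp [span₄, cell]),
    hp true false true false (W := {i, k}) (by simp [span₄, cell]),
    hp true false false true (W := {i, l}) (by simp [span₄, cell]),
    hp false true true false (W := {j, k}) (by simp [span₄, cell]),
    hp false true false true (W := {j, l}) (by simp [span₄, cell]),
    hp false false true true (W := {k, l}) (by simp [span₄, cell]),
    hp true true true true (W := {i, j, k, l}) (by simp [span₄, cell])] at htop
  have hsingle : ∀ a ∈ ({i, j, k, l} : Finset ι), decide (symmDiff F {a} ∈ 𝓕) = false :=
    fun a ha => decide_eq_false (hodd {a} (by simpa using ha) (by simp))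
  have hi := hsingle i (by simp)
  have hj := hsingle j (by simp)
  have hk := hsingle k (by simp)
  have hl := hsingle l (by simp)
  refine decide_eq_true_iff.symm.trans ?_
  rw [nonsing_quadruple (fund_isSymm 𝓕 F) hij hik hil hjk hjl hkl (by simp [fund_self, hi, toGF2])
    (by simp [fund_self, hj, toGF2]) (by simp [fund_self, hk, toGF2])
    (by simp [fund_self, hl, toGF2]), fund_ne _ _ hij, fund_ne _ _ hik, fund_ne _ _ hil,
    fund_ne _ _ hjk, fund_ne _ _ hjl, fund_ne _ _ hkl, hi, hj, hk, hl, htop]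
  generalize decide (symmDiff F {i, j} ∈ 𝓕) = a, decide (symmDiff F {i, k} ∈ 𝓕) = b,
    decide (symmDiff F {i, l} ∈ 𝓕) = c, decide (symmDiff F {j, k} ∈ 𝓕) = d,
    decide (symmDiff F {j, l} ∈ 𝓕) = e, decide (symmDiff F {k, l} ∈ 𝓕) = f
  revert a b c d e f
  decide +kernel

/-- Pivoting on a feasible proper subset `Y` of `W` reduces the claim for `W` to smaller sets. -/
theorem mem_iff_nonsing_fund_of_pivot {W Y : Finset ι}
    (ih : ∀ F ∈ 𝓕, ∀ Z, #Z < #W → (symmDiff F Z ∈ 𝓕 ↔ Nonsing (fund 𝓕 F) Z)) (hF : F ∈ 𝓕)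
    (hYW : Y ⊆ W) (hY : Y.Nonempty) (hFY : symmDiff F Y ∈ 𝓕) (hcard : 3 ≤ #(W \ Y)) :
    symmDiff F W ∈ 𝓕 ↔ Nonsing (fund 𝓕 F) W := by
  have hsum := card_sdiff_add_card_eq_card hYW
  have hYpos := hY.card_pos
  obtain ⟨N, hN, hNF⟩ := exists_pivot (fund_isSymm 𝓕 F) ((ih F hF Y (by omega)).1 hFY)
  have hWY : symmDiff Y (W \ Y) = W := by
    ext a; have := @hYW a; simp only [mem_symmDiff, mem_sdiff]; tauto
  have hagree : ∀ Z ⊆ W \ Y, #Z ≤ 2 → (Nonsing N Z ↔ Nonsing (fund 𝓕 (symmDiff F Y)) Z) := by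
    intro Z hZ hZ2
    have hcardYZ : #(symmDiff Y Z) < #W := by
      have : symmDiff Y Z ⊆ Y ∪ Z := symmDiff_le_sup
      have := (card_le_card this).trans (card_union_le _ _)
      omega
    rw [hNF, ← ih F hF _ hcardYZ, ← symmDiff_assoc, mem_iff_nonsing_fund_of_card_le_two hFY hZ2]
  rw [← hWY, ← hNF, ← symmDiff_assoc, ih _ hFY _ (by omega)]
  exact (nonsing_congr (entry_eq_of_nonsing_iff hN (fund_isSymm _ _) hagree)).symm

theorem not_nonsing_of_eq_zero {M : Matrix ι ι (ZMod 2)} {W : Finset ι} (hW : W.Nonempty)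
    (h : ∀ i ∈ W, ∀ j ∈ W, M i j = 0) : ¬ Nonsing M W := by
  obtain ⟨i, hi⟩ := hW
  rw [nonsing_congr (N := 0) h]
  intro h0
  have := congrFun (h0 (Pi.single i 1) (fun a ha => Pi.single_eq_of_ne (by grind) _) (by simp)) i
  simp at this

theorem mem_iff_nonsing_fund (hexch : Exchange 𝓕)
    (h : ∀ S ∈ [S₁, S₂, S₃, S₄, S₅], Excludes 𝓕 S) :
    ∀ F ∈ 𝓕, ∀ W, symmDiff F W ∈ 𝓕 ↔ Nonsing (fund 𝓕 F) W := by
  classical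
  have h₁ := h S₁ (by simp)
  have h₂ := h S₂ (by simp)
  have h₃ := h S₃ (by simp)
  have h₄ := h S₄ (by simp)
  have h₅ := h S₅ (by simp)
  intro F hF W
  induction hn : #W using Nat.strong_induction_on generalizing F W with
  | _ n ih =>
  subst hn
  replace ih : ∀ F ∈ 𝓕, ∀ Z, #Z < #W → (symmDiff F Z ∈ 𝓕 ↔ Nonsing (fund 𝓕 F) Z) :=
    fun F hF Z hZ => ih _ hZ F hF Z rfl
  by_cases hY : ∃ Y ⊆ W, Y.Nonempty ∧ symmDiff F Y ∈ 𝓕 ∧ 3 ≤ #(W \ Y)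
  · obtain ⟨Y, hYW, hY, hFY, hcard⟩ := hY
    exact mem_iff_nonsing_fund_of_pivot ih hF hYW hY hFY hcard
  have hno : ∀ Y ⊆ W, Y.Nonempty → #Y + 3 ≤ #W → symmDiff F Y ∉ 𝓕 := by
    intro Y hYW hne hcard hmem
    have := card_sdiff_add_card_eq_card hYW
    exact hY ⟨Y, hYW, hne, hmem, by omega⟩
  obtain h2 | h3 | h4 | h5 : #W ≤ 2 ∨ #W = 3 ∨ #W = 4 ∨ 5 ≤ #W := by omega
  · exact mem_iff_nonsing_fund_of_card_le_two hF h2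
  · obtain ⟨i, j, k, hij, hik, hjk, rfl⟩ := card_eq_three.1 h3
    exact mem_iff_nonsing_fund_triple hexch h₁ h₂ h₃ hF hij hik hjk
  · have hsingle : ∀ a ∈ W, fund 𝓕 F a a = 0 := fun a ha => by
      have := hno {a} (by simpa using ha) (by simp) (by simp [h4])
      simp [fund_self, this, toGF2]
    have hodd : ∀ Z ⊆ W, #Z = 1 ∨ #Z = 3 → symmDiff F Z ∉ 𝓕 := by
      rintro Z hZ (hZ1 | hZ3)
      · exact hno Z hZ (card_pos.1 (by omega)) (by omega)
      · obtain ⟨i, j, k, hij, hik, hjk, rfl⟩ := card_eq_three.1 hZ3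
        rw [ih F hF _ (by omega), nonsing_triple _ hij hik hjk, (fund_isSymm 𝓕 F).apply i j,
          (fund_isSymm 𝓕 F).apply i k, (fund_isSymm 𝓕 F).apply j k, hsingle i (hZ (by simp)),
          hsingle j (hZ (by simp)), hsingle k (hZ (by simp))]
        generalize fund 𝓕 F i j = a, fund 𝓕 F i k = b, fund 𝓕 F j k = c
        revert a b c
        decide
    obtain ⟨i, Z, hiZ, rfl, hZ⟩ := card_eq_succ.1 h4
    obtain ⟨j, k, l, hjk, hjl, hkl, rfl⟩ := card_eq_three.1 hZ
    simp only [mem_insert, mem_singleton, not_or] at hiZ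
    exact mem_iff_nonsing_fund_quadruple hexch h₄ h₅ hF hiZ.1 hiZ.2.1 hiZ.2.2 hjk hjl hkl hodd
  · have hpair : ∀ i ∈ W, ∀ j ∈ W, symmDiff F {i, j} ∉ 𝓕 := fun i hi j hj =>
      hno {i, j} (by simp [insert_subset_iff, hi, hj]) (by simp)
        (by have := card_le_two (a := i) (b := j); omega)
    have hsingle : ∀ i ∈ W, symmDiff F {i} ∉ 𝓕 := fun i hi => by simpa using hpair i hi i hi
    have hne : W.Nonempty := card_pos.1 (by omega)
    refine iff_of_false (fun hmem => ?_) (not_nonsing_of_eq_zero hne fun i hi j hj => ?_)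
    · obtain ⟨i, hi⟩ := hne
      have hd : symmDiff F (symmDiff F W) = W := symmDiff_symmDiff_cancel_left F W
      obtain ⟨j, hj, hij⟩ := hexch F hF _ hmem i (by rwa [hd])
      rw [hd] at hj
      exact hpair i hi j hj hij
    · obtain rfl | hij := eq_or_ne i j
      · simp [fund_self, hsingle i hi, toGF2]
      · simp [fund_ne _ _ hij, hsingle i hi, hsingle j hj, hpair i hi j hj, toGF2]

end Families

section SetSystems

variable {α : Type*} [DecidableEq α]

theorem exists_minor_restrict (D : SetSystem α) (hD : ∀ F ∈ D.F, F ⊆ D.E) {F X : Finset α}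
    (hF : F ∈ D.F) (hX : X ⊆ D.E) :
    ∃ T, IsMinor D T ∧ T.E = X ∧ ∀ Z, Z ∈ T.F ↔ Z ⊆ X ∧ Z ∪ (F \ X) ∈ D.F := by
  induction hn : #(D.E \ X) generalizing D F with
  | zero =>
    have hXE : X = D.E := hX.antisymm (sdiff_eq_empty_iff_subset.1 (card_eq_zero.1 hn))
    refine ⟨D, .refl D, hXE.symm, fun Z => ?_⟩
    rw [hXE, sdiff_eq_empty_iff_subset.2 (hD F hF), union_empty]
    exact ⟨fun h => ⟨hD Z h, h⟩, And.right⟩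
  | succ n ih =>
    obtain ⟨e, he⟩ : (D.E \ X).Nonempty := card_pos.1 (by omega)
    obtain ⟨heE, heX⟩ := mem_sdiff.1 he
    have hXe : X ⊆ D.E.erase e := subset_erase.2 ⟨hX, heX⟩
    have hcard : #(D.E.erase e \ X) = n := by
      rw [erase_sdiff_comm, card_erase_of_mem he, hn, Nat.add_sub_cancel]
    have hFE := hD F hF
    by_cases heF : e ∈ F
    · have hF' : F.erase e ∈ (D.contr e).F :=
        ⟨erase_subset_erase e hFE, by rwa [union_comm, ← insert_eq, insert_erase heF]⟩
      obtain ⟨T, hT, hTE, hTF⟩ := ih (D.contr e) (fun _ h => h.1) hF' hXe hcard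
      refine ⟨T, .contr e heE ⟨_, hF'⟩ hT, hTE, fun Z => ?_⟩
      rw [hTF]
      refine and_congr_right fun hZ => ?_
      have hset : Z ∪ (F.erase e \ X) ∪ {e} = Z ∪ (F \ X) := by
        ext a; simp only [mem_union, mem_sdiff, mem_erase, mem_singleton]; grind
      have hsub : Z ∪ (F.erase e \ X) ⊆ D.E.erase e :=
        union_subset (hZ.trans hXe) (sdiff_subset.trans (erase_subset_erase e hFE))
      change _ ∧ _ ↔ _
      rw [hset]
      exact and_iff_right hsub
    · have hF' : F ∈ (D.del e).F := ⟨subset_erase.2 ⟨hFE, heF⟩, hF⟩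
      obtain ⟨T, hT, hTE, hTF⟩ := ih (D.del e) (fun _ h => h.1) hF' hXe hcard
      refine ⟨T, .del e heE ⟨_, hF'⟩ hT, hTE, fun Z => ?_⟩
      rw [hTF]
      refine and_congr_right fun hZ => ?_
      exact and_iff_right (union_subset (hZ.trans hXe) (sdiff_subset.trans hF'.1))

theorem image_symmDiff_of_injOn {β : Type*} [DecidableEq β] {f : α → β} {X A B : Finset α}
    (hf : Set.InjOn f X) (hA : A ⊆ X) (hB : B ⊆ X) :
    (symmDiff A B).image f = symmDiff (A.image f) (B.image f) := by
  ext b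
  simp only [mem_image, mem_symmDiff]
  constructor
  · rintro ⟨a, ⟨ha, hb⟩ | ⟨ha, hb⟩, rfl⟩
    · exact .inl ⟨⟨a, ha, rfl⟩, fun ⟨c, hc, hca⟩ => hb (hf (hB hc) (hA ha) hca ▸ hc)⟩
    · exact .inr ⟨⟨a, ha, rfl⟩, fun ⟨c, hc, hca⟩ => hb (hf (hA hc) (hB ha) hca ▸ hc)⟩
  · rintro (⟨⟨a, ha, rfl⟩, hb⟩ | ⟨⟨a, ha, rfl⟩, hb⟩)
    · exact ⟨a, .inl ⟨ha, fun h => hb ⟨a, h, rfl⟩⟩, rfl⟩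
    · exact ⟨a, .inr ⟨ha, fun h => hb ⟨a, h, rfl⟩⟩, rfl⟩

/-- The feasible sets of `D` as subsets of the type `D.E`. -/
def feasible (D : SetSystem α) : Set (Finset D.E) :=
  {W | W.map (Function.Embedding.subtype _) ∈ D.F}

theorem exists_map_subtype {E W : Finset α} (h : W ⊆ E) :
    ∃ V : Finset E, V.map (Function.Embedding.subtype _) = W :=
  ⟨W.subtype (· ∈ E), subtype_map_of_mem h⟩

theorem map_symmDiff_subtype {E : Finset α} (A B : Finset E) :
    (symmDiff A B).map (Function.Embedding.subtype (· ∈ E)) =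
      symmDiff (A.map (Function.Embedding.subtype _)) (B.map (Function.Embedding.subtype _)) := by
  simp only [map_eq_image]
  exact image_symmDiff _ _ (Function.Embedding.injective _)

theorem exchange_feasible {D : SetSystem α} (hD : D.IsDeltaMatroid) : Exchange (feasible D) := by
  intro F₁ h₁ F₂ h₂ x hx
  obtain ⟨y, hy, hxy⟩ := hD.2.2 _ h₁ _ h₂ x (by
    rw [← map_symmDiff_subtype]; exact mem_map_of_mem _ hx)
  rw [← map_symmDiff_subtype] at hy
  obtain ⟨y, hy', rfl⟩ := mem_map.1 hy
  refine ⟨y, hy', ?_⟩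
  rw [feasible, Set.mem_ofPred_eq, map_symmDiff_subtype]
  simpa using hxy

theorem excludes_feasible {D : SetSystem α} (hD : ∀ F ∈ D.F, F ⊆ D.E) {S : SetSystem ℕ}
    (hS : ∀ W ∈ S.F, W ⊆ S.E)
    (h : ∀ T, IsMinor D T → ∀ A ⊆ S.E, ¬ T.Isomorphic (S.twist A)) : Excludes (feasible D) S := by
  intro F hF X φ hinj hE hall
  let ι : D.E ↪ α := Function.Embedding.subtype _
  let ψ : α → ℕ := fun a => if ha : a ∈ D.E then φ ⟨a, ha⟩ else 0
  have hψ : ∀ a : D.E, ψ (ι a) = φ a := fun a => by simp [ψ, ι]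
  have himage : ∀ Z : Finset D.E, (Z.map ι).image ψ = Z.image φ := fun Z => by
    rw [map_eq_image, image_image]
    exact image_congr fun a _ => hψ a
  have hsub : ∀ Z : Finset D.E, Z.map ι ⊆ D.E := fun Z => map_subtype_subset Z
  obtain ⟨T, hT, hTE, hTF⟩ := exists_minor_restrict D hD hF (hsub X)
  have hmem : ∀ Z ⊆ X, (Z.map ι ∈ T.F ↔ (symmDiff (F ∩ X) Z).image φ ∈ S.F) := by
    intro Z hZ
    have hset : symmDiff F (symmDiff (F ∩ X) Z) = Z ∪ (F \ X) := by
      ext a; have := @hZ a; simp only [mem_symmDiff, mem_union, mem_inter, mem_sdiff]; tauto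
    rw [hTF, ← hall _ fun a ha => ?_, hset, and_iff_right (map_subset_map.2 hZ)]
    · simp only [feasible, Set.mem_ofPred_eq, map_union, Finset.map_sdiff]
      rfl
    · have := @hZ a
      simp only [mem_symmDiff, mem_inter] at ha
      tauto
  have hFX : F ∩ X ⊆ X := inter_subset_right
  refine h T hT ((F ∩ X).image φ) (hE ▸ image_subset_image hFX) ⟨ψ, ?_, ?_, ?_⟩
  · rw [hTE, coe_map]
    rintro _ ⟨a, ha, rfl⟩ _ ⟨b, hb, rfl⟩ hab
    exact congrArg ι (hinj ha hb (by rwa [← hψ, ← hψ]))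
  · rw [hTE]
    exact (himage X).trans hE
  · ext Y
    constructor
    · rintro ⟨W, hW, rfl⟩
      obtain ⟨V, hV, rfl⟩ := subset_image_iff.1 ((hS W hW).trans hE.ge)
      have hVX : V ⊆ X := by exact_mod_cast hV
      refine ⟨(symmDiff (F ∩ X) V).map ι, ?_, ?_⟩
      · rw [hmem _ (symmDiff_le_sup.trans (union_subset hFX hVX)), symmDiff_symmDiff_cancel_left]
        exact hW
      · rw [himage, image_symmDiff_of_injOn hinj hFX hVX]
    · rintro ⟨Z, hZ, rfl⟩
      obtain ⟨V, rfl⟩ := exists_map_subtype (((hTF Z).1 hZ).1.trans (hsub X))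
      have hVX : V ⊆ X := map_subset_map.1 ((hTF _).1 hZ).1
      refine ⟨_, (hmem V hVX).1 hZ, ?_⟩
      rw [image_symmDiff_of_injOn hinj hFX hVX, symmDiff_symmDiff_cancel_left]
      exact himage V

theorem map_mem_ofMatrix {E : Finset α} (A : Matrix E E (ZMod 2)) (W : Finset E) :
    W.map (Function.Embedding.subtype _) ∈ (ofMatrix E A).F ↔ Nonsing A W := by
  have hsub : ∀ x ∈ W.map (Function.Embedding.subtype _), x ∈ E := map_subtype_subset W
  let f : ↥(W.map (Function.Embedding.subtype _)) ↪ E :=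
    ⟨fun i => ⟨i.1, hsub i.1 i.2⟩, fun _ _ hab => Subtype.ext (Subtype.mk.inj hab)⟩
  have hf : univ.map f = W := by
    ext a
    simp only [mem_map, mem_univ, true_and]
    constructor
    · rintro ⟨⟨b, hb⟩, rfl⟩
      obtain ⟨c, hc, rfl⟩ := mem_map.1 hb
      exact hc
    · exact fun ha => ⟨⟨a.1, mem_map_of_mem _ ha⟩, rfl⟩
  refine (exists_prop_of_true hsub).trans ?_
  rw [Matrix.isUnit_iff_isUnit_det, isUnit_iff_ne_zero]
  exact (hf ▸ nonsing_map A f).symm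

theorem isBinary_of_feasible {D : SetSystem α} (hD : ∀ F ∈ D.F, F ⊆ D.E)
    {A : Matrix D.E D.E (ZMod 2)} (hA : A.IsSymm) {F : Finset D.E} (hF : F ∈ feasible D)
    (h : ∀ W, symmDiff F W ∈ feasible D ↔ Nonsing A W) : D.IsBinary := by
  refine ⟨_, hF, A, hA, ?_⟩
  have hDF : D.F = ((ofMatrix D.E A).twist (F.map (Function.Embedding.subtype _))).F := by
    ext Y
    constructor
    · intro hY
      obtain ⟨V, rfl⟩ := exists_map_subtype (hD Y hY)
      refine ⟨(symmDiff F V).map (Function.Embedding.subtype _), ?_, ?_⟩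
      · rw [map_mem_ofMatrix, ← h, symmDiff_symmDiff_cancel_left]
        exact hY
      · rw [← map_symmDiff_subtype, symmDiff_symmDiff_cancel_left]
    · rintro ⟨X, hX, rfl⟩
      obtain ⟨V, rfl⟩ := exists_map_subtype (E := D.E) fun x hx => hX.1 x hx
      rw [map_mem_ofMatrix, ← h] at hX
      rw [← map_symmDiff_subtype]
      exact hX
  calc D = ⟨D.E, D.F⟩ := rfl
    _ = _ := by rw [hDF]; rfl

theorem subset_ground_of_mem_list :
    ∀ S ∈ [S₁, S₂, S₃, S₄, S₅], ∀ W ∈ S.F, W ⊆ S.E := by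
  simp only [List.forall_mem_cons, S₁, S₂, S₃, S₄, S₅, Set.mem_insert_iff, Set.mem_singleton_iff,
    forall_eq_or_imp, forall_eq]
  simp
  decide

end SetSystems

end BinaryDeltaMatroid

/-- a delta-matroid with no minor isomorphic to a twist of one of
`S₁, …, S₅` is binary. -/
theorem stmt_14 {α : Type*} [DecidableEq α] (D : SetSystem α)
    (hD : D.IsDeltaMatroid)
    (h : ∀ T : SetSystem α, IsMinor D T →
      ∀ S ∈ [S₁, S₂, S₃, S₄, S₅], ∀ A : Finset ℕ, A ⊆ S.E →
        ¬ T.Isomorphic (S.twist A)) :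
    D.IsBinary := by
  obtain ⟨F, hF⟩ := hD.1
  obtain ⟨F, rfl⟩ := BinaryDeltaMatroid.exists_map_subtype (hD.2.1 F hF)
  exact BinaryDeltaMatroid.isBinary_of_feasible hD.2.1 (BinaryDeltaMatroid.fund_isSymm _ F) hF
    (BinaryDeltaMatroid.mem_iff_nonsing_fund (BinaryDeltaMatroid.exchange_feasible hD)
      (fun S hS => BinaryDeltaMatroid.excludes_feasible hD.2.1
        (BinaryDeltaMatroid.subset_ground_of_mem_list S hS) fun T hT A hA => h T hT S hS A hA) F hF)
end

section
/- Let E be a finite set and let A = (a_{vw} : v, w ∈ E) be a symmetric matrix over GF(2). Then D(A) = (E, {W ⊆ E : the principal submatrix A[W] = (a_{vw} : v, w ∈ W) is invertible}), with the convention that A[∅] is invertible, is a delta-matroid. -/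
open SetSystem

namespace Matrix

variable {ι K : Type*} [Fintype ι] [DecidableEq ι] [Field K]

open scoped Classical in
/-- The matrix whose rows indexed by `S` are those of `A`, and whose other rows are those of the
identity. It is invertible exactly when the principal submatrix `A[S]` is. -/
noncomputable def rowPiecewise (A : Matrix ι ι K) (S : Set ι) : Matrix ι ι K :=
  Matrix.of fun i => if i ∈ S then A i else (1 : Matrix ι ι K) i

open scoped Classical in
lemma rowPiecewise_mulVec (A : Matrix ι ι K) (S : Set ι) (v : ι → K) (i : ι) :
    (A.rowPiecewise S *ᵥ v) i = if i ∈ S then (A *ᵥ v) i else v i := by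
  by_cases h : i ∈ S
  · simp [rowPiecewise, mulVec, h]
  · have := congrFun (one_mulVec v) i
    simpa [rowPiecewise, mulVec, h] using this

lemma isUnit_iff_forall_mulVec_eq_zero (M : Matrix ι ι K) :
    IsUnit M ↔ ∀ v, M *ᵥ v = 0 → v = 0 := by
  rw [← mulVec_injective_iff_isUnit]
  exact injective_iff_map_eq_zero M.mulVecLin

lemma isUnit_submatrix_iff_isUnit_rowPiecewise {m : Type*} [Fintype m] [DecidableEq m]
    (A : Matrix ι ι K) {f : m → ι} (hf : Function.Injective f) :
    IsUnit (A.submatrix f f) ↔ IsUnit (A.rowPiecewise (Set.range f)) := by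
  have submatrix_mulVec_comp (v : ι → K) (hv : ∀ i ∉ Set.range f, v i = 0) (j : m) :
      (A.submatrix f f *ᵥ (v ∘ f)) j = (A *ᵥ v) (f j) := by
    simp only [mulVec, dotProduct, submatrix_apply, Function.comp_apply]
    refine Fintype.sum_of_injective f hf _ _ (fun i hi => ?_) fun _ => rfl
    rw [hv i hi, mul_zero]
  simp only [isUnit_iff_forall_mulVec_eq_zero]
  constructor
  · intro h v hv
    have hv' i := (rowPiecewise_mulVec A (Set.range f) v i).symm.trans (congrFun hv i)
    have hout : ∀ i ∉ Set.range f, v i = 0 := fun i hi => by simpa [hi] using hv' i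
    have hzero := h (v ∘ f) (funext fun j => by
      rw [submatrix_mulVec_comp v hout]
      simpa using hv' (f j))
    ext i
    by_cases hi : i ∈ Set.range f
    · obtain ⟨j, rfl⟩ := hi
      exact congrFun hzero j
    · exact hout i hi
  · intro h w hw
    have hout : ∀ i ∉ Set.range f, Function.extend f w 0 i = 0 := fun i hi =>
      Function.extend_apply' w (0 : ι → K) i hi
    have hcomp : Function.extend f w 0 ∘ f = w := Function.extend_comp hf w (0 : ι → K)
    rw [← hcomp, h (Function.extend f w 0)]
    · rfl
    ext i
    rw [rowPiecewise_mulVec]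
    split_ifs with hi
    · obtain ⟨j, rfl⟩ := hi
      rw [← submatrix_mulVec_comp _ hout, hcomp, hw]
      rfl
    · exact hout i hi

lemma rowPiecewise_dotProduct_compl_comm [CharP K 2] {A : Matrix ι ι K} (hA : A.IsSymm)
    (S : Set ι) (u v : ι → K) :
    (A.rowPiecewise S *ᵥ u) ⬝ᵥ (A.rowPiecewise Sᶜ *ᵥ v) =
      (A.rowPiecewise Sᶜ *ᵥ u) ⬝ᵥ (A.rowPiecewise S *ᵥ v) := by
  have hsymm : u ⬝ᵥ (A *ᵥ v) = (A *ᵥ u) ⬝ᵥ v := by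
    rw [dotProduct_mulVec, ← mulVec_transpose, hA]
  rw [← CharTwo.add_eq_zero] at hsymm ⊢
  rw [← hsymm]
  simp only [dotProduct, ← Finset.sum_add_distrib, rowPiecewise_mulVec]
  refine Finset.sum_congr rfl fun i _ => ?_
  by_cases hi : i ∈ S <;> simp [hi, add_comm]

lemma rowPiecewise_symmDiff_mulVec_of_mem (A : Matrix ι ι K) {S T : Set ι} {i : ι} (hi : i ∈ T)
    (v : ι → K) :
    (A.rowPiecewise (symmDiff S T) *ᵥ v) i = (A.rowPiecewise Sᶜ *ᵥ v) i := by
  by_cases hS : i ∈ S <;> simp [rowPiecewise_mulVec, Set.mem_symmDiff, hi, hS]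

lemma rowPiecewise_symmDiff_mulVec_of_notMem (A : Matrix ι ι K) {S T : Set ι} {i : ι} (hi : i ∉ T)
    (v : ι → K) :
    (A.rowPiecewise (symmDiff S T) *ᵥ v) i = (A.rowPiecewise S *ᵥ v) i := by
  by_cases hS : i ∈ S <;> simp [rowPiecewise_mulVec, Set.mem_symmDiff, hi, hS]

theorem exists_isUnit_rowPiecewise_symmDiff_pair [CharP K 2] {A : Matrix ι ι K} (hA : A.IsSymm)
    {S T : Set ι} (hS : IsUnit (A.rowPiecewise S)) (hT : IsUnit (A.rowPiecewise T))
    {x : ι} (hx : x ∈ symmDiff S T) :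
    ∃ y ∈ symmDiff S T, IsUnit (A.rowPiecewise (symmDiff S {x, y})) := by
  set P := A.rowPiecewise S with hP
  set Q := A.rowPiecewise Sᶜ with hQ
  have hinj : Function.Injective P.mulVec := mulVec_injective_iff_isUnit.2 hS
  have hsurj : Function.Surjective P.mulVec := mulVec_surjective_iff_isUnit.2 hS
  choose u hu using fun i => hsurj (Pi.single i (1 : K))
  have hcomm (i j : ι) : (Q *ᵥ u i) j = (Q *ᵥ u j) i := by
    have := rowPiecewise_dotProduct_compl_comm hA S (u i) (u j)
    rw [← hP, ← hQ] at this
    simpa [hu] using this.symm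
  obtain ⟨y, hy, hyx⟩ : ∃ y ∈ symmDiff S T, (Q *ᵥ u x) y ≠ 0 := by
    by_contra! h
    have hux : u x = 0 := by
      refine (isUnit_iff_forall_mulVec_eq_zero _).1 hT _ (funext fun i => ?_)
      rw [← symmDiff_symmDiff_cancel_left S T]
      by_cases hi : i ∈ symmDiff S T
      · rw [rowPiecewise_symmDiff_mulVec_of_mem A hi]
        exact h i hi
      · rw [rowPiecewise_symmDiff_mulVec_of_notMem A hi, ← hP, hu,
          Pi.single_eq_of_ne (by rintro rfl; exact hi hx)]
        rfl
    have := congrFun (hu x) x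
    simp [hux] at this
  by_cases hxx : (Q *ᵥ u x) x = 0
  · have hne : x ≠ y := fun h => hyx (h ▸ hxx)
    refine ⟨y, hy, (isUnit_iff_forall_mulVec_eq_zero _).2 fun v hv => ?_⟩
    have hv_eq : v = (P *ᵥ v) x • u x + (P *ᵥ v) y • u y := by
      apply hinj
      ext i
      simp only [mulVec_add, mulVec_smul, hu, Pi.add_apply, Pi.smul_apply, smul_eq_mul]
      by_cases hix : i = x
      · subst hix; simp [hne]
      by_cases hiy : i = y
      · subst hiy; simp [hix]
      have := congrFun hv i
      rw [rowPiecewise_symmDiff_mulVec_of_notMem A (by simp [hix, hiy])] at this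
      simpa [hix, hiy] using this
    have hQx : (Q *ᵥ v) x = 0 := by
      exact (rowPiecewise_symmDiff_mulVec_of_mem A (by simp) v).symm.trans (congrFun hv x)
    have hQy : (Q *ᵥ v) y = 0 := by
      exact (rowPiecewise_symmDiff_mulVec_of_mem A (by simp) v).symm.trans (congrFun hv y)
    have hb : (P *ᵥ v) y = 0 := by
      rw [hv_eq] at hQx
      simpa [mulVec_add, mulVec_smul, hxx, hcomm y x, hyx] using hQx
    have ha : (P *ᵥ v) x = 0 := by
      rw [hv_eq, hb] at hQy
      simpa [mulVec_smul, hyx] using hQy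
    rw [hv_eq, ha, hb]
    simp
  · refine ⟨x, hx, (isUnit_iff_forall_mulVec_eq_zero _).2 fun v hv => ?_⟩
    rw [Set.pair_eq_singleton] at hv
    have hv_eq : v = (P *ᵥ v) x • u x := by
      apply hinj
      ext i
      simp only [mulVec_smul, hu, Pi.smul_apply, smul_eq_mul]
      by_cases hix : i = x
      · subst hix; simp
      have := congrFun hv i
      rw [rowPiecewise_symmDiff_mulVec_of_notMem A (by simp [hix])] at this
      simpa [hix] using this
    have hQx : (Q *ᵥ v) x = 0 := by
      exact (rowPiecewise_symmDiff_mulVec_of_mem A (by simp) v).symm.trans (congrFun hv x)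
    have ha : (P *ᵥ v) x = 0 := by
      rw [hv_eq] at hQx
      simpa [mulVec_smul, hxx] using hQx
    rw [hv_eq, ha, zero_smul]

end Matrix

lemma SetSystem.mem_ofMatrix_iff {α : Type*} [DecidableEq α] {E : Finset α}
    {A : Matrix E E (ZMod 2)} {W : Finset α} :
    W ∈ (SetSystem.ofMatrix E A).F ↔
      W ⊆ E ∧ IsUnit (A.rowPiecewise {e : E | e.1 ∈ W}) := by
  simp only [SetSystem.ofMatrix, Set.mem_ofPred_eq, ← exists_prop]
  refine exists_congr fun h => ?_
  have hrange : Set.range (fun i : W => (⟨i.1, h i.1 i.2⟩ : E)) = {e : E | e.1 ∈ W} := by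
    ext e
    exact ⟨by rintro ⟨i, rfl⟩; exact i.2, fun he => ⟨⟨e.1, he⟩, rfl⟩⟩
  rw [← hrange]
  exact Matrix.isUnit_submatrix_iff_isUnit_rowPiecewise A fun i j hij =>
    Subtype.ext (congrArg (fun e : E => e.1) hij)

/-- for a symmetric matrix `A` over GF(2) indexed by a finite set
`E`, the set system `D(A)` is a delta-matroid. -/
theorem stmt_15 {α : Type*} [DecidableEq α] (E : Finset α)
    (A : Matrix E E (ZMod 2)) (hA : A.IsSymm) :
    (SetSystem.ofMatrix E A).IsDeltaMatroid := by
  have setOf_symmDiff (X Y : Finset α) :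
      {e : E | e.1 ∈ symmDiff X Y} = symmDiff {e : E | e.1 ∈ X} {e : E | e.1 ∈ Y} := by
    ext e
    simp [Finset.mem_symmDiff, Set.mem_symmDiff]
  refine ⟨⟨∅, SetSystem.mem_ofMatrix_iff.2 ⟨Finset.empty_subset E, ?_⟩⟩,
    fun F hF => (SetSystem.mem_ofMatrix_iff.1 hF).1, fun F₁ h₁ F₂ h₂ x hx => ?_⟩
  · have hone : A.rowPiecewise {e : E | e.1 ∈ (∅ : Finset α)} = 1 := by
      ext i j
      simp [Matrix.rowPiecewise]
    rw [hone]
    exact isUnit_one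
  · obtain ⟨hF₁, hu₁⟩ := SetSystem.mem_ofMatrix_iff.1 h₁
    obtain ⟨hF₂, hu₂⟩ := SetSystem.mem_ofMatrix_iff.1 h₂
    have hxE : x ∈ E := by
      rcases Finset.mem_symmDiff.1 hx with h | h
      · exact hF₁ h.1
      · exact hF₂ h.1
    obtain ⟨y, hy, hunit⟩ := Matrix.exists_isUnit_rowPiecewise_symmDiff_pair hA hu₁ hu₂
      (x := ⟨x, hxE⟩) (by rwa [← setOf_symmDiff])
    refine ⟨y, by rwa [← setOf_symmDiff] at hy, SetSystem.mem_ofMatrix_iff.2 ⟨?_, ?_⟩⟩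
    · intro e he
      rcases Finset.mem_symmDiff.1 he with h | h
      · exact hF₁ h.1
      · rcases Finset.mem_insert.1 h.1 with rfl | h'
        · exact hxE
        · exact Finset.mem_singleton.1 h' ▸ y.2
    · have hpair : {e : E | e.1 ∈ ({x, y.1} : Finset α)} = {⟨x, hxE⟩, y} := by
        ext e
        simp only [Set.mem_ofPred_eq, Finset.mem_insert, Finset.mem_singleton,
          Set.mem_insert_iff, Set.mem_singleton_iff, Subtype.ext_iff]
      rwa [setOf_symmDiff, hpair]
end

section
/- Let S₂ = ({1,2,3}, {∅, {1}, {2}, {3}, {1,2}, {1,3}, {2,3}}). Then the handle slide (S₂⋆{1})₁₂ equals the set system ({1,2,3}, {∅, {1,2}, {1,3}, {2}, {3}, {1,2,3}}) and is a delta-matroid, even though (S₂)₁₂ is not a delta-matroid. In particular, a twist of a set system whose handle slide fails to be a delta-matroid can have a handle slide that is a delta-matroid. -/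
open SetSystem

namespace SetSystem

variable {α : Type*} [DecidableEq α]

lemma twist_coe (E A : Finset α) (𝓕 : Finset (Finset α)) :
    (⟨E, 𝓕⟩ : SetSystem α).twist A = ⟨E, (𝓕.image (symmDiff A) : Finset (Finset α))⟩ := by
  simp only [twist, mk.injEq, true_and]
  ext Y
  simp [eq_comm]

lemma slide_coe (E : Finset α) (𝓕 : Finset (Finset α)) (a b : α) :
    (⟨E, 𝓕⟩ : SetSystem α).slide a b =
      ⟨E, (symmDiff 𝓕 (((E \ {a, b}).powerset.filter (· ∪ {b} ∈ 𝓕)).image (· ∪ {a})) :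
        Finset (Finset α))⟩ := by
  simp only [slide, mk.injEq, true_and, Finset.coe_symmDiff]
  congr 1
  ext Y
  simp only [Set.mem_ofPred_eq, Finset.mem_coe, Finset.mem_image, Finset.mem_filter,
    Finset.mem_powerset, and_assoc, eq_comm]

lemma isDeltaMatroid_coe_iff (E : Finset α) (𝓕 : Finset (Finset α)) :
    (⟨E, 𝓕⟩ : SetSystem α).IsDeltaMatroid ↔
      𝓕.Nonempty ∧ (∀ F ∈ 𝓕, F ⊆ E) ∧
        ∀ F₁ ∈ 𝓕, ∀ F₂ ∈ 𝓕, ∀ x ∈ symmDiff F₁ F₂,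
          ∃ y ∈ symmDiff F₁ F₂, symmDiff F₁ {x, y} ∈ 𝓕 :=
  Iff.rfl

end SetSystem

lemma S₂_eq_coe :
    S₂ = ⟨{1, 2, 3}, (({∅, {1}, {2}, {3}, {1, 2}, {1, 3}, {2, 3}} : Finset (Finset ℕ)) :
      Set (Finset ℕ))⟩ := by
  simp [S₂]

lemma slide_twist_S₂ :
    (S₂.twist {1}).slide 1 2 =
      ⟨{1, 2, 3}, (({∅, {1, 2}, {1, 3}, {2}, {3}, {1, 2, 3}} : Finset (Finset ℕ)) :
        Set (Finset ℕ))⟩ := by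
  rw [S₂_eq_coe, twist_coe, slide_coe]
  congr 2

lemma slide_S₂ :
    S₂.slide 1 2 =
      ⟨{1, 2, 3}, (({∅, {2}, {3}, {1, 2}, {2, 3}} : Finset (Finset ℕ)) :
        Set (Finset ℕ))⟩ := by
  rw [S₂_eq_coe, slide_coe]
  congr 2

/-- `(S₂⋆{1})₁₂ = ({1,2,3}, {∅, {1,2}, {1,3}, {2}, {3}, {1,2,3}})`
is a delta-matroid, although `(S₂)₁₂` is not. -/
theorem stmt_17 :
    (S₂.twist {1}).slide 1 2 =
      (⟨{1, 2, 3}, {∅, {1, 2}, {1, 3}, {2}, {3}, {1, 2, 3}}⟩ : SetSystem ℕ) ∧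
    ((S₂.twist {1}).slide 1 2).IsDeltaMatroid ∧
    ¬ (S₂.slide 1 2).IsDeltaMatroid := by
  refine ⟨?_, ?_, ?_⟩
  · simp [slide_twist_S₂]
  · rw [slide_twist_S₂, isDeltaMatroid_coe_iff]
    decide
  · rw [slide_S₂, isDeltaMatroid_coe_iff]
    decide
end
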